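/- arXiv:2101.04105 — 2 statements merged into one kernel-verified Lean document; each statement's English description precedes it below -/
import Mathlib

section
/- Let n ≥ 2 be an integer with n ≡ 0 or 1 (mod 4). Then the polynomial Q_n(z) = 1 − z^n − (1 − z)^n has at least two zeros on the vertical line Re(z) = 1/2: there exist real numbers t_1 < 0 < t_2 such that Q_n(1/2 + i t_1) = 0 and Q_n(1/2 + i t_2) = 0. -/
open Complex

/-- In polar form, the equation `Q_n(1/2 + it) = 0` with `t = tan θ / 2` reads
`2 cos (n θ) = (2 cos θ)ⁿ`. -/
lemma Qn_eq_zero_of_two_mul_cos_mul_eq (n : ℕ) {θ : ℝ} (hθ : Real.cos θ ≠ 0)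
    (h : 2 * Real.cos (n * θ) = (2 * Real.cos θ) ^ n) :
    1 - ((1 / 2 : ℂ) + (Real.tan θ / 2 : ℝ) * I) ^ n
      - (1 - ((1 / 2 : ℂ) + (Real.tan θ / 2 : ℝ) * I)) ^ n = 0 := by
  have hc : Complex.cos θ ≠ 0 := by rw [← ofReal_cos]; exact_mod_cast hθ
  have hz : 2 * Complex.cos θ * ((1 / 2 : ℂ) + (Real.tan θ / 2 : ℝ) * I)
      = Complex.cos θ + Complex.sin θ * I := by
    push_cast
    rw [Complex.tan]
    field_simp
  have hw : 2 * Complex.cos θ * (1 - ((1 / 2 : ℂ) + (Real.tan θ / 2 : ℝ) * I))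
      = Complex.cos (-θ) + Complex.sin (-θ) * I := by
    rw [mul_sub, hz, Complex.cos_neg, Complex.sin_neg]
    ring
  have hz' := congrArg (· ^ n) hz
  have hw' := congrArg (· ^ n) hw
  simp only [mul_pow (2 * Complex.cos θ), cos_add_sin_mul_I_pow] at hz' hw'
  rw [mul_neg, Complex.cos_neg, Complex.sin_neg] at hw'
  have h' : 2 * Complex.cos (n * θ) = (2 * Complex.cos θ) ^ n := by exact_mod_cast h
  refine (mul_eq_zero_iff_left (pow_ne_zero n (mul_ne_zero two_ne_zero hc))).mp ?_
  linear_combination -hz' - hw' - h'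

/-- For `n ≥ 2` with `n ≡ 0` or `1 (mod 4)`, the equation `2 cos (n θ) = (2 cos θ)ⁿ` has a
solution strictly between `0` and `π / 2`. -/
lemma exists_two_mul_cos_mul_eq (n : ℕ) (hn : 2 ≤ n) (hmod : n % 4 = 0 ∨ n % 4 = 1) :
    ∃ θ ∈ Set.Ioo 0 (Real.pi / 2), 2 * Real.cos (n * θ) = (2 * Real.cos θ) ^ n := by
  obtain ⟨k, hk, hkn, hnk⟩ : ∃ k : ℕ, 1 ≤ k ∧ 4 * k ≤ n ∧ n ≤ 4 * k + 1 :=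
    ⟨n / 4, by omega, by omega, by omega⟩
  have hk' : (1 : ℝ) ≤ k := by exact_mod_cast hk
  have hkn' : (4 * k : ℝ) ≤ n := by exact_mod_cast hkn
  have hnk' : (n : ℝ) ≤ 4 * k + 1 := by exact_mod_cast hnk
  have hn0 : (0 : ℝ) < n := by linarith
  have hpi := Real.pi_pos
  -- At `b` the left side is maximal while `2 cos b ≤ 1`.
  set b : ℝ := k * (2 * Real.pi) / n with hb
  have hb_le : b ≤ Real.pi / 2 := by
    rw [hb, div_le_iff₀ hn0]
    nlinarith
  have hb_ge : Real.pi / 3 ≤ b := by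
    rw [hb, le_div_iff₀ hn0]
    nlinarith
  have hcos_nb : Real.cos (n * b) = 1 := by
    rw [hb, mul_div_cancel₀ _ hn0.ne', Real.cos_nat_mul_two_pi]
  have hcos_nonneg : 0 ≤ Real.cos b := Real.cos_nonneg_of_mem_Icc ⟨by linarith, hb_le⟩
  have hcos_le : Real.cos b ≤ 1 / 2 := by
    rw [← Real.cos_pi_div_three]
    exact Real.cos_le_cos_of_nonneg_of_le_pi (by linarith) (by linarith) hb_ge
  have hpow_b : (2 * Real.cos b) ^ n ≤ 1 := pow_le_one₀ (by linarith) (by linarith)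
  have hpow_zero : (2 : ℝ) < 2 ^ n := lt_self_pow₀ one_lt_two (by omega)
  have hcont : ContinuousOn (fun θ : ℝ => 2 * Real.cos (n * θ) - (2 * Real.cos θ) ^ n)
      (Set.Icc 0 b) := by fun_prop
  obtain ⟨θ, hθ, h⟩ := intermediate_value_Ioo (by linarith) hcont
    (show (0 : ℝ) ∈ Set.Ioo _ _ by
      constructor
      · simpa using hpow_zero
      · simp only [hcos_nb]
        linarith)
  exact ⟨θ, ⟨hθ.1, hθ.2.trans_le hb_le⟩, sub_eq_zero.mp h⟩

/-- For `n ≥ 2` with `n ≡ 0` or `1 (mod 4)`, the polynomial `Q_n(z) = 1 - zⁿ - (1 - z)ⁿ`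
has at least two zeros on the vertical line `Re z = 1/2`: one with negative and one with
positive imaginary part. -/
theorem Qn_zeros_on_critical_line (n : ℕ) (hn : 2 ≤ n) (hmod : n % 4 = 0 ∨ n % 4 = 1) :
    ∃ t₁ t₂ : ℝ, t₁ < 0 ∧ 0 < t₂ ∧
      1 - ((1 / 2 : ℂ) + t₁ * I) ^ n - (1 - ((1 / 2 : ℂ) + t₁ * I)) ^ n = 0 ∧
      1 - ((1 / 2 : ℂ) + t₂ * I) ^ n - (1 - ((1 / 2 : ℂ) + t₂ * I)) ^ n = 0 := by
  obtain ⟨θ, ⟨hθ₀, hθ₁⟩, h⟩ := exists_two_mul_cos_mul_eq n hn hmod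
  have hcos : Real.cos θ ≠ 0 := (Real.cos_pos_of_mem_Ioo ⟨by linarith, hθ₁⟩).ne'
  have htan : 0 < Real.tan θ := Real.tan_pos_of_pos_of_lt_pi_div_two hθ₀ hθ₁
  refine ⟨Real.tan (-θ) / 2, Real.tan θ / 2, ?_, by linarith, ?_, ?_⟩
  · rw [Real.tan_neg]
    linarith
  · exact Qn_eq_zero_of_two_mul_cos_mul_eq n (by rwa [Real.cos_neg])
      (by rwa [mul_neg, Real.cos_neg, Real.cos_neg])
  · exact Qn_eq_zero_of_two_mul_cos_mul_eq n hcos h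
end

section
/- Let A be a unital C*-algebra and φ : A → ℂ a state (a positive linear functional with φ(1) = 1) which is tracial, i.e. φ(ab) = φ(ba) for all a, b ∈ A. If b ∈ A is an idempotent (b² = b, not necessarily self-adjoint), then φ(b) is a real number lying in the interval [0, 1]. -/
/-- In a unital C*-algebra, `1 + a⋆a` is invertible. -/
theorem isUnit_one_add_star_mul_self
    {A : Type*} [NormedRing A] [StarRing A] [CStarRing A] [CompleteSpace A]
    [NormedAlgebra ℂ A] [StarModule ℂ A] (a : A) : IsUnit (1 + star a * a) := by
  let _ : CStarAlgebra A := {}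
  by_contra h
  have hmem : (-1 : ℝ) ∈ spectrum ℝ (star a * a) := by
    rw [spectrum.mem_iff]
    intro hu
    apply h
    rw [← IsUnit.neg_iff]
    convert hu using 1
    simp only [map_neg, map_one]
    abel
  have := spectrum_star_mul_self_nonneg (-1) hmem
  norm_num at this

/-- Kaplansky's theorem: every idempotent `b` of a unital C*-algebra has a range projection
`p`, that is, a projection with `pb = b` and `bp = p`. -/
theorem exists_isStarProjection_mul_eq_of_isIdempotentElem
    {A : Type*} [NormedRing A] [StarRing A] [CStarRing A] [CompleteSpace A]
    [NormedAlgebra ℂ A] [StarModule ℂ A] {b : A} (hb : IsIdempotentElem b) :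
    ∃ p : A, IsStarProjection p ∧ p * b = b ∧ b * p = p := by
  have hb' : b * b = b := hb
  have hbs : star b * star b = star b := by rw [← star_mul, hb']
  obtain ⟨z, hz⟩ := isUnit_one_add_star_mul_self (b - star b)
  have hz' : (z : A) = 1 - b - star b + b * star b + star b * b := by
    rw [hz]
    simp only [star_sub, star_star, mul_sub, sub_mul, hb', hbs]
    abel
  have hbz : b * z = b * star b * b := by
    rw [hz']
    simp only [mul_add, mul_sub, mul_one, ← mul_assoc, hb']
    abel
  have hzb : z * b = b * star b * b := by
    rw [hz']
    simp only [add_mul, sub_mul, one_mul, mul_assoc, hb']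
    abel
  have hzs : star (z : A) = z := by
    rw [hz]
    simp
  have hcb : Commute b (z : A) := hbz.trans hzb.symm
  have hcs : Commute (star b) (z : A) := by
    have := hcb.star_star
    rwa [hzs] at this
  have hcb' : Commute b (↑z⁻¹ : A) := hcb.units_inv_right
  have hc' : Commute (b * star b) (↑z⁻¹ : A) := hcb'.mul_left hcs.units_inv_right
  have hzis : star (↑z⁻¹ : A) = ↑z⁻¹ := by
    have hu : star z = z := Units.ext hzs
    rw [← Units.coe_star, star_inv, hu]
  have hpb : b * star b * ↑z⁻¹ * b = b := by
    rw [mul_assoc, ← hcb'.eq, ← mul_assoc, ← hbz, mul_assoc, Units.mul_inv, mul_one]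
  refine ⟨b * star b * ↑z⁻¹, ⟨?_, ?_⟩, hpb, ?_⟩
  · change b * star b * ↑z⁻¹ * (b * star b * ↑z⁻¹) = _
    rw [← mul_assoc, ← mul_assoc, hpb]
  · change star _ = _
    rw [star_mul, star_mul, star_star, hzis, hc'.eq]
  · rw [← mul_assoc, ← mul_assoc, hb']

/-- A positive tracial functional on a unital C*-algebra is nonnegative on idempotents. -/
theorem exists_nonneg_apply_eq_of_isIdempotentElem
    {A : Type*} [NormedRing A] [StarRing A] [CStarRing A] [CompleteSpace A]
    [NormedAlgebra ℂ A] [StarModule ℂ A]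
    (φ : A →ₗ[ℂ] ℂ)
    (hφpos : ∀ a : A, ∃ r : ℝ, 0 ≤ r ∧ φ (star a * a) = (r : ℂ))
    (hφtr : ∀ a b : A, φ (a * b) = φ (b * a))
    {b : A} (hb : IsIdempotentElem b) :
    ∃ r : ℝ, 0 ≤ r ∧ φ b = (r : ℂ) := by
  obtain ⟨p, hp, hpb, hbp⟩ := exists_isStarProjection_mul_eq_of_isIdempotentElem hb
  have hφ : φ b = φ (star p * p) := by
    rw [hp.isSelfAdjoint.star_eq, hp.isIdempotentElem.eq, ← hbp, ← hφtr, hpb]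
  rw [hφ]
  exact hφpos p


/-- If `φ` is a tracial state on a unital C*-algebra `A` and `b ∈ A` is an idempotent
(not necessarily self-adjoint), then `φ(b)` is a real number in `[0, 1]`. -/
theorem tracial_state_apply_idempotent_mem_unitInterval
    {A : Type*} [NormedRing A] [StarRing A] [CStarRing A] [CompleteSpace A]
    [NormedAlgebra ℂ A] [StarModule ℂ A]
    (φ : A →ₗ[ℂ] ℂ) (hφ1 : φ 1 = 1)
    (hφpos : ∀ a : A, ∃ r : ℝ, 0 ≤ r ∧ φ (star a * a) = (r : ℂ))
    (hφtr : ∀ a b : A, φ (a * b) = φ (b * a))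
    (b : A) (hb_idem : b * b = b) :
    ∃ r : ℝ, φ b = (r : ℂ) ∧ 0 ≤ r ∧ r ≤ 1 := by
  have hb : IsIdempotentElem b := hb_idem
  obtain ⟨r, hr, hrb⟩ := exists_nonneg_apply_eq_of_isIdempotentElem φ hφpos hφtr hb
  obtain ⟨s, hs, hsb⟩ := exists_nonneg_apply_eq_of_isIdempotentElem φ hφpos hφtr hb.one_sub
  refine ⟨r, hrb, hr, ?_⟩
  rw [map_sub, hφ1, hrb] at hsb
  have hrs : 1 - r = s := by exact_mod_cast hsb
  linarith
end
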